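/- There exists a real constant $\delta^*$ with $0<\delta^*\leq 1/13$ such that there is no datum as in the hyperquotient setup satisfying all of: $\delta\leq\delta^*$; Rules I and II; the odd form; and $a\not\equiv b \pmod r$. -/

import Mathlib

open scoped BigOperators

namespace GapPaper

/-- Least non-negative residue of `n` modulo `r` (for `r > 0`). -/
def res (r n : ℤ) : ℤ := n % r

/-- The lattice `N = ℤ⁴ + ℤ·(1/r)(a,b,c,d)` inside `ℚ⁴`. -/
def latN (r a b c d : ℤ) : Set (Fin 4 → ℚ) :=
  {v | ∃ (j : ℤ) (m : Fin 4 → ℤ), ∀ i,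
    v i = ((j * ![a, b, c, d] i : ℤ) : ℚ) / (r : ℚ) + (m i : ℚ)}

/-- The positive orthant `σ`. -/
def orth : Set (Fin 4 → ℚ) := {v | ∀ i, 0 ≤ v i}

/-- The weight `w(v) = v₁ + v₂ + v₃ + v₄`. -/
def w (v : Fin 4 → ℚ) : ℚ := ∑ i, v i

/-- `v(f)`: the infimum over the monomials `m ∈ S` of their `v`-weights. -/
noncomputable def vf (S : Set (Fin 4 → ℕ)) (v : Fin 4 → ℚ) : ℝ :=
  sInf {x : ℝ | ∃ m ∈ S, x = ∑ i : Fin 4, (m i : ℝ) * ((v i : ℚ) : ℝ)}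

/-- `v` is primitive in the lattice `N`. -/
def IsPrim (r a b c d : ℤ) (v : Fin 4 → ℚ) : Prop :=
  ¬ ∃ (n : ℤ) (u : Fin 4 → ℚ), 2 ≤ n ∧ u ∈ latN r a b c d ∧ v = fun i => (n : ℚ) * u i

/-- The excluded set `{0, e₁, e₂, e₃, e₄}`. -/
def corners : Set (Fin 4 → ℚ) :=
  {v | v = 0 ∨ ∃ i₀ : Fin 4, v = fun i => if i = i₀ then 1 else 0}

/-- Every monomial of `S` has weight `e` for the `μ_r`-action with weights
`(a, b, c, d)`. -/
def WeightCond (r a b c d e : ℤ) (S : Set (Fin 4 → ℕ)) : Prop :=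
  ∀ m ∈ S, Int.ModEq r ((m 0 : ℤ) * a + (m 1 : ℤ) * b + (m 2 : ℤ) * c + (m 3 : ℤ) * d) e

/-- Rule I: `B` is a set with at most one element, whose element `β` (if any) is
primitive and satisfies `1 - δ < w(β) - β(f) < 1`, and every lattice vector in the
orthant other than `β`, `0`, `e₁`, ..., `e₄` satisfies `w(v) - v(f) > 1`. -/
def RuleI (r a b c d : ℤ) (δ : ℝ) (S : Set (Fin 4 → ℕ)) (B : Set (Fin 4 → ℚ)) : Prop :=
  B.Subsingleton ∧ B ⊆ latN r a b c d ∩ orth ∧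
    (∀ β ∈ B, IsPrim r a b c d β ∧
      1 - δ < ((w β : ℚ) : ℝ) - vf S β ∧ ((w β : ℚ) : ℝ) - vf S β < 1) ∧
    ∀ v ∈ latN r a b c d ∩ orth, v ∉ B → v ∉ corners → 1 < ((w v : ℚ) : ℝ) - vf S v

/-- Rule II. -/
def RuleII (r a b c d e : ℤ) : Prop :=
  (Int.gcd a r ∣ Int.gcd e r) ∧ (Int.gcd b r ∣ Int.gcd e r) ∧
  (Int.gcd c r ∣ Int.gcd e r) ∧ (Int.gcd d r ∣ Int.gcd e r) ∧
  Int.gcd a (Int.gcd b r) = 1 ∧ Int.gcd a (Int.gcd c r) = 1 ∧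
  Int.gcd a (Int.gcd d r) = 1 ∧ Int.gcd b (Int.gcd c r) = 1 ∧
  Int.gcd b (Int.gcd d r) = 1 ∧ Int.gcd c (Int.gcd d r) = 1 ∧
  Int.ModEq r (a + b + c + d - e) 1

/-- The vector `α_k = (1/r)(res(ak), res(bk), res(ck), res(dk))`. -/
def alphaK (r a b c d k : ℤ) : Fin 4 → ℚ :=
  fun i => ((res r (![a, b, c, d] i * k) : ℤ) : ℚ) / (r : ℚ)

/-- The unit cube `[0,1]⁴` minus its 16 vertices. -/
def cube : Set (Fin 4 → ℚ) :=
  {v | (∀ i, 0 ≤ v i ∧ v i ≤ 1) ∧ ¬ ∀ i, v i = 0 ∨ v i = 1}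

/-- The cA form: `f = xy + g(z,t)` with `g ∈ 𝔪²`. -/
def FormCA (S : Set (Fin 4 → ℕ)) : Prop :=
  ![1, 1, 0, 0] ∈ S ∧
    ∀ m ∈ S, m ≠ ![1, 1, 0, 0] → m 0 = 0 ∧ m 1 = 0 ∧ 2 ≤ m 2 + m 3

/-- The square form: `f = x² + (terms of order ≥ 2)`. -/
def FormSq (S : Set (Fin 4 → ℕ)) : Prop :=
  ![2, 0, 0, 0] ∈ S ∧ ∀ m ∈ S, 2 ≤ m 0 + m 1 + m 2 + m 3

/-- The odd form: `f = x² + y² + g(z,t)` with `g ∈ 𝔪³`. -/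
def FormOdd (S : Set (Fin 4 → ℕ)) : Prop :=
  ![2, 0, 0, 0] ∈ S ∧ ![0, 2, 0, 0] ∈ S ∧
    ∀ m ∈ S, m ≠ ![2, 0, 0, 0] → m ≠ ![0, 2, 0, 0] →
      m 0 = 0 ∧ m 1 = 0 ∧ 3 ≤ m 2 + m 3

/-- The cD–E form: `f = x² + g(y,z,t)` with `g ∈ 𝔪³`. -/
def FormCDE (S : Set (Fin 4 → ℕ)) : Prop :=
  ![2, 0, 0, 0] ∈ S ∧ ∀ m ∈ S, m ≠ ![2, 0, 0, 0] → m 0 = 0 ∧ 3 ≤ m 1 + m 2 + m 3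

def Xk (r a b c d k : ℤ) : Fin 4 → ℤ := fun i => (-(k * ![a, b, c, d] i)) % r

lemma vf_eq (S : Set (Fin 4 → ℕ)) (X : Fin 4 → ℤ) (r : ℤ) (hr : 0 < r)
    (h1 : ![2, 0, 0, 0] ∈ S) (h2 : ![0, 2, 0, 0] ∈ S)
    (hq : ∀ m ∈ S, 2 * min (X 0) (X 1) ≤ ∑ i, (m i : ℤ) * X i) :
    vf S (fun i => (X i : ℚ) / r) = ((2 * min (X 0) (X 1) : ℤ) : ℝ) / r := by
  have hr' : (0 : ℝ) < r := by exact_mod_cast hr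
  unfold vf
  apply IsLeast.csInf_eq
  constructor
  · rcases le_total (X 0) (X 1) with h | h
    · refine ⟨_, h1, ?_⟩
      simp [Fin.sum_univ_four, min_eq_left h]
      ring
    · refine ⟨_, h2, ?_⟩
      simp [Fin.sum_univ_four, min_eq_right h]
      ring
  · rintro x ⟨m, hm, rfl⟩
    have := hq m hm
    have h3 : ((2 * min (X 0) (X 1) : ℤ) : ℝ) ≤ ((∑ i, (m i : ℤ) * X i : ℤ) : ℝ) := by
      exact_mod_cast this
    have h4 : (∑ i : Fin 4, (m i : ℝ) * (((X i : ℚ) / (r : ℚ) : ℚ) : ℝ))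
        = ((∑ i, (m i : ℤ) * X i : ℤ) : ℝ) / r := by
      simp [Fin.sum_univ_four]
      ring
    rw [h4]
    gcongr

lemma core (r : ℤ) (δ : ℝ) (a b c d e : ℤ) (S : Set (Fin 4 → ℕ)) (B : Set (Fin 4 → ℚ))
    (hr : 13 < r) (hδ0 : 0 < δ) (hδ : δ ≤ 1 / 1000)
    (hI : RuleI r a b c d δ S B)
    (h1 : ![2, 0, 0, 0] ∈ S) (h2 : ![0, 2, 0, 0] ∈ S)
    (hW : ∀ k, Int.ModEq r (∑ i, Xk r a b c d k i - 2 * Xk r a b c d k 0) (-k))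
    (hW' : ∀ k, Int.ModEq r (∑ i, Xk r a b c d k i - 2 * Xk r a b c d k 1) (-k)) :
    ∃ κ : ℤ, 0 ≤ κ ∧ 1000 * κ < r ∧ ∀ k, 0 < k → k < r → k ≠ κ →
      (Xk r a b c d k 0 ≠ 0 ∨ Xk r a b c d k 1 ≠ 0) →
      (∀ m ∈ S, 2 * min (Xk r a b c d k 0) (Xk r a b c d k 1)
        ≤ ∑ i, (m i : ℤ) * Xk r a b c d k i) →
      r < ∑ i, Xk r a b c d k i - 2 * min (Xk r a b c d k 0) (Xk r a b c d k 1) := by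
  have hr0 : 0 < r := by omega
  have hrR : (0 : ℝ) < r := by exact_mod_cast hr0
  have hrQ : (r : ℚ) ≠ 0 := by exact_mod_cast hr0.ne'
  obtain ⟨hsub, -, hB, hN⟩ := hI
  set X := Xk r a b c d with hX
  have hXnn : ∀ k i, 0 ≤ X k i := fun k i => Int.emod_nonneg _ hr0.ne'
  have hXlt : ∀ k i, X k i < r := fun k i => Int.emod_lt_of_pos _ hr0
  let v : ℤ → Fin 4 → ℚ := fun k i => (X k i : ℚ) / r
  have hmem : ∀ k, v k ∈ latN r a b c d ∩ orth := by
    intro k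
    constructor
    · refine ⟨-k, fun i => -((-(k * ![a, b, c, d] i)) / r), fun i => ?_⟩
      have := Int.mul_ediv_add_emod (-(k * ![a, b, c, d] i)) r
      have h3 : X k i = -k * ![a, b, c, d] i - r * ((-(k * ![a, b, c, d] i)) / r) := by
        simp only [hX, Xk]; linarith
      simp only [v]
      rw [h3]
      push_cast
      field_simp
      ring
    · intro i
      simp only [v]
      have := hXnn k i
      have h4 : (0 : ℚ) ≤ X k i := by exact_mod_cast this
      have h5 : (0 : ℚ) < r := by exact_mod_cast hr0
      positivity
  have hcor : ∀ k, v k ∈ corners → X k 0 = 0 ∧ X k 1 = 0 := by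
    intro k hk
    have key : ∀ i, v k i = 0 ∨ v k i = 1 := by
      rcases hk with h | ⟨i0, h⟩
      · intro i; left; rw [h]; rfl
      · intro i; rw [h]
        by_cases hi : i = i0
        · right; simp [hi]
        · left; simp [hi]
    have key2 : ∀ i, X k i = 0 := by
      intro i
      rcases key i with h | h
      · simp only [v] at h
        rw [div_eq_zero_iff] at h
        rcases h with h | h
        · exact_mod_cast h
        · exact absurd h hrQ
      · simp only [v] at h
        rw [div_eq_one_iff_eq hrQ] at h
        have h6 : X k i = r := by exact_mod_cast h
        have := hXlt k i
        omega
    exact ⟨key2 0, key2 1⟩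
  let W : ℤ → ℤ := fun k => ∑ i, X k i - 2 * min (X k 0) (X k 1)
  have hWm : ∀ k, Int.ModEq r (W k) (-k) := by
    intro k
    simp only [W]
    rcases le_total (X k 0) (X k 1) with h | h
    · rw [min_eq_left h]; exact hW k
    · rw [min_eq_right h]; exact hW' k
  let Q : ℤ → Prop := fun k => ∀ m ∈ S, 2 * min (X k 0) (X k 1) ≤ ∑ i, (m i : ℤ) * X k i
  have hdiff : ∀ k, Q k → ((w (v k) : ℚ) : ℝ) - vf S (v k) = (W k : ℝ) / r := by
    intro k hk
    have h := vf_eq S (X k) r hr0 h1 h2 hk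
    have h' : vf S (v k) = ((2 * min (X k 0) (X k 1) : ℤ) : ℝ) / r := h
    rw [h']
    have h3 : ((w (v k) : ℚ) : ℝ) = ((∑ i, X k i : ℤ) : ℝ) / r := by
      simp [w, v, Fin.sum_univ_four]
      ring
    rw [h3, ← sub_div, ← Int.cast_sub]
  have hbad : ∀ k, 0 < k → k < r → Q k → v k ∈ B → W k = r - k ∧ 1000 * k < r := by
    intro k hk0 hkr hQ hvB
    obtain ⟨-, hl, hu⟩ := hB _ hvB
    rw [hdiff k hQ] at hl hu
    rw [lt_div_iff₀ hrR] at hl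
    rw [div_lt_one hrR] at hu
    have hu' : W k < r := by exact_mod_cast hu
    have hl0 : (0 : ℝ) < W k := by nlinarith
    have hl' : 0 < W k := by exact_mod_cast hl0
    have hmod : W k = r - k := by
      have h := (hWm k).symm.dvd
      obtain ⟨q, hq⟩ := h
      have : q = 1 := by
        have h1 : q < 2 := by nlinarith
        have h2 : 0 < q := by nlinarith
        omega
      subst this
      linarith
    refine ⟨hmod, ?_⟩
    rw [hmod] at hl
    push_cast at hl
    have : (1000 * k : ℝ) < r := by nlinarith
    exact_mod_cast this
  by_cases hex : ∃ κ, 0 < κ ∧ κ < r ∧ Q κ ∧ v κ ∈ B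
  · obtain ⟨κ, hκ0, hκr, hκQ, hκB⟩ := hex
    obtain ⟨e1, e2⟩ := hbad κ hκ0 hκr hκQ hκB
    refine ⟨κ, hκ0.le, e2, ?_⟩
    intro k hk0 hkr hne hX0 hQ
    have hnB : v k ∉ B := by
      intro hvB
      have heq := hsub hvB hκB
      obtain ⟨e3, e4⟩ := hbad k hk0 hkr hQ hvB
      have h5 := hdiff k hQ
      rw [heq, hdiff κ hκQ, div_left_inj' hrR.ne'] at h5
      have h6 : W κ = W k := by exact_mod_cast h5
      omega
    have h7 := hN (v k) (hmem k) hnB (fun h => by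
      obtain ⟨p, q⟩ := hcor k h; tauto)
    rw [hdiff k hQ, lt_div_iff₀ hrR, one_mul] at h7
    exact_mod_cast h7
  · refine ⟨0, le_rfl, by omega, ?_⟩
    intro k hk0 hkr hne hX0 hQ
    have hnB : v k ∉ B := fun hvB => hex ⟨k, hk0, hkr, hQ, hvB⟩
    have h7 := hN (v k) (hmem k) hnB (fun h => by
      obtain ⟨p, q⟩ := hcor k h; tauto)
    rw [hdiff k hQ, lt_div_iff₀ hrR, one_mul] at h7
    exact_mod_cast h7

/-- main passage argument for small `c` -/
lemma passage (s c κ : ℤ) (hs : 7 ≤ s) (hκ0 : 0 ≤ κ) (hκ : 1000 * κ < 2 * s)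
    (hc3 : 3 ≤ c) (h3 : 3 * c < s + 3)
    (hκ3 : κ ≠ 5 ∨ 11 * c ≤ 3 * s) (h7 : ¬ (s = 7 ∧ c = 3))
    (hP : ∀ k, 0 < k → k < s → k % 2 = 1 → k ≠ κ →
      ∃ m, 2 * s * m < c * k ∧ c * k < 2 * s * m + s + k) : False := by
  obtain ⟨t, rfl⟩ : ∃ t, c = t + 1 := ⟨c - 1, by ring⟩
  have ht : 2 ≤ t := by omega
  obtain ⟨j, hj1, hj2⟩ : ∃ j : ℤ, (2 * j - 1) * t ≤ s - 1 ∧ s - 1 < (2 * j + 1) * t := by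
    refine ⟨(s - 1 + t) / (2 * t), ?_, ?_⟩
    · have := Int.mul_ediv_self_le (x := s - 1 + t) (k := 2 * t) (by omega)
      nlinarith
    · have := Int.lt_mul_ediv_self_add (x := s - 1 + t) (k := 2 * t) (by omega)
      nlinarith
  have hj : 2 ≤ j := by
    by_contra hcon
    have : (2 * j + 1) * t ≤ 3 * t := by nlinarith
    omega
  have hu : 3 ≤ 2 * j - 1 := by omega
  generalize hu' : 2 * j - 1 = u at *
  have hk : 2 * j + 1 = u + 2 := by omega
  rw [hk] at hj2
  have hodd : u % 2 = 1 := by omega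
  clear hk hu'
  have hmul : 2 * u + 3 * t ≤ s + 5 := by nlinarith
  have hb : u + 2 * t + 1 ≤ s := by
    rcases le_or_gt 10 s with h | h
    · omega
    · have : t = 2 := by omega
      subst this
      omega
  by_cases hne : u + 2 = κ
  · -- exceptional
    obtain ⟨m, hm1, hm2⟩ := hP (u + 4) (by omega) (by omega) (by omega) (by omega)
    have hm : 1 ≤ m := by
      by_contra hcon
      have : s * m ≤ 0 := by nlinarith
      nlinarith
    have hs' : 2 * s ≤ 2 * s * m := by nlinarith
    have hs4 : 4 * t + u + 5 > s := by nlinarith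
    have hu4 : u ≤ 4 := by
      by_contra hcon
      have : 5 * t ≤ u * t := by nlinarith
      omega
    have : u = 3 := by omega
    subst this
    rcases hκ3 with h | h
    · omega
    · omega
  · obtain ⟨m, hm1, hm2⟩ := hP (u + 2) (by omega) (by omega) (by omega) hne
    rcases le_or_gt m 0 with h | h
    · have : s * m ≤ 0 := by nlinarith
      nlinarith
    · have : 2 * s ≤ 2 * s * m := by nlinarith
      nlinarith

lemma mcases (s m : ℤ) (hs : 0 < s) (h0 : -(2 * s) < 2 * s * m) (h1 : 2 * s * m < 2 * s * 7) :
    m = 0 ∨ m = 1 ∨ m = 2 ∨ m = 3 ∨ m = 4 ∨ m = 5 ∨ m = 6 := by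
  have : -1 < m := by nlinarith
  have : m < 7 := by nlinarith
  omega

lemma oddstage (s c d κ : ℤ) (hs : 7 ≤ s) (hκ0 : 0 ≤ κ) (hκ : 1000 * κ < 2 * s)
    (hc : 0 ≤ c) (hcd : c ≤ d) (hsum : c + d = s + 1)
    (hP : ∀ k, 0 < k → k < s → k % 2 = 1 → k ≠ κ →
      ∃ m, 2 * s * m < c * k ∧ c * k < 2 * s * m + s + k) :
    c = 1 ∨ c = 2 ∨ (s = 7 ∧ c = 3) := by
  by_contra hcon
  have P' : ∀ k, 0 < k → k < s → k ≤ 11 → k % 2 = 1 → k ≠ κ →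
      ∃ m, 2 * s * m < c * k ∧ c * k < 2 * s * m + s + k ∧
      (m = 0 ∨ m = 1 ∨ m = 2 ∨ m = 3 ∨ m = 4 ∨ m = 5 ∨ m = 6) := by
    intro k h1 h2 h3 h4 h5
    obtain ⟨m, hm1, hm2⟩ := hP k h1 h2 h4 h5
    refine ⟨m, hm1, hm2, mcases s m (by omega) ?_ ?_⟩
    · nlinarith
    · nlinarith
  have hc0 : c ≠ 0 := by
    rintro rfl
    obtain ⟨m, hm1, hm2, hm⟩ : ∃ m, 2 * s * m < 0 ∧ 0 < 2 * s * m + s + 5 ∧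
      (m = 0 ∨ m = 1 ∨ m = 2 ∨ m = 3 ∨ m = 4 ∨ m = 5 ∨ m = 6) := by
      by_cases h5 : κ = 5
      · obtain ⟨m, hm1, hm2, hm⟩ := P' 3 (by omega) (by omega) (by omega) (by omega) (by omega)
        exact ⟨m, by linarith, by linarith, hm⟩
      · obtain ⟨m, hm1, hm2, hm⟩ := P' 5 (by omega) (by omega) (by omega) (by omega) (by omega)
        exact ⟨m, by linarith, by linarith, hm⟩
    rcases hm with rfl | rfl | rfl | rfl | rfl | rfl | rfl <;> omega
  by_cases hk3 : κ = 3
  · obtain ⟨m, hm1, hm2, hm⟩ := P' 5 (by omega) (by omega) (by omega) (by omega) (by omega)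
    obtain ⟨n, hn1, hn2, hn⟩ := P' 7 (by omega) (by omega) (by omega) (by omega) (by omega)
    obtain ⟨l, hl1, hl2, hl⟩ := P' 9 (by omega) (by omega) (by omega) (by omega) (by omega)
    have h5 : 5 * c < s + 5 := by
      rcases hm with rfl | rfl | rfl | rfl | rfl | rfl | rfl <;> try omega
      rcases hn with rfl | rfl | rfl | rfl | rfl | rfl | rfl <;> try omega
      rcases hl with rfl | rfl | rfl | rfl | rfl | rfl | rfl <;> omega
    exact passage s c κ hs hκ0 hκ (by omega) (by omega) (by omega) (by omega) hP
  · obtain ⟨m, hm1, hm2, hm⟩ := P' 3 (by omega) (by omega) (by omega) (by omega) (by omega)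
    have h3 : 3 * c < s + 3 := by
      rcases hm with rfl | rfl | rfl | rfl | rfl | rfl | rfl <;> omega
    refine passage s c κ hs hκ0 hκ (by omega) h3 ?_ (by omega) hP
    by_cases h5 : κ = 5
    · right
      subst h5
      by_contra hh
      obtain ⟨l, hl1, hl2, hl⟩ := P' 11 (by omega) (by omega) (by omega) (by omega) (by omega)
      obtain ⟨n, hn1, hn2, hn⟩ := P' 7 (by omega) (by omega) (by omega) (by omega) (by omega)
      rcases hl with rfl | rfl | rfl | rfl | rfl | rfl | rfl <;> try omega
      rcases hn with rfl | rfl | rfl | rfl | rfl | rfl | rfl <;> omega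
    · left; exact h5

lemma odd_big (s c d κ : ℤ) (hs : 7 ≤ s) (hκ0 : 0 ≤ κ) (hκ : 1000 * κ < 2 * s)
    (hc : c < 2 * s) (hcd : d ≤ c) (hsum : c + d = 3 * s + 1)
    (hP : ∀ k, 0 < k → k < s → k % 2 = 1 → k ≠ κ →
      ∃ m, 2 * s * m < c * k ∧ c * k < 2 * s * m + s + k) : False := by
  have P' : ∀ k, 0 < k → k < s → k ≤ 7 → k % 2 = 1 → k ≠ κ →
      ∃ m, 2 * s * m < c * k ∧ c * k < 2 * s * m + s + k ∧
      (m = 0 ∨ m = 1 ∨ m = 2 ∨ m = 3 ∨ m = 4 ∨ m = 5 ∨ m = 6) := by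
    intro k h1 h2 h3 h4 h5
    obtain ⟨m, hm1, hm2⟩ := hP k h1 h2 h4 h5
    refine ⟨m, hm1, hm2, mcases s m (by omega) ?_ ?_⟩
    · nlinarith
    · nlinarith
  by_cases h1 : κ = 1
  · obtain ⟨m, hm1, hm2, hm⟩ := P' 3 (by omega) (by omega) (by omega) (by omega) (by omega)
    obtain ⟨n, hn1, hn2, hn⟩ := P' 5 (by omega) (by omega) (by omega) (by omega) (by omega)
    obtain ⟨l, hl1, hl2, hl⟩ := P' 7 (by omega) (by omega) (by omega) (by omega) (by omega)
    rcases hm with rfl | rfl | rfl | rfl | rfl | rfl | rfl <;> try omega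
    all_goals rcases hn with rfl | rfl | rfl | rfl | rfl | rfl | rfl <;> try omega
    all_goals rcases hl with rfl | rfl | rfl | rfl | rfl | rfl | rfl <;> omega
  · obtain ⟨m, hm1, hm2, hm⟩ := P' 1 (by omega) (by omega) (by omega) (by omega) (by omega)
    rcases hm with rfl | rfl | rfl | rfl | rfl | rfl | rfl <;> omega

lemma astage (s a κ : ℤ) (hs : 7 ≤ s) (hκ0 : 0 ≤ κ) (hκ : 1000 * κ < 2 * s)
    (ha0 : 0 < a) (has : a < s)
    (hE : ∀ j, 0 < j → 2 * j < s → 2 * j ≠ κ → ∃ m, s * m ≤ a * j ∧ 2 * (a * j) < 2 * s * m + s) :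
    a = 1 := by
  by_contra hcon
  have E' : ∀ j, 0 < j → 2 * j < s → j ≤ 5 → 2 * j ≠ κ → ∃ m, s * m ≤ a * j ∧
      2 * (a * j) < 2 * s * m + s ∧ (m = 0 ∨ m = 1 ∨ m = 2 ∨ m = 3 ∨ m = 4 ∨ m = 5 ∨ m = 6) := by
    intro j h1 h2 h3 h4
    obtain ⟨m, hm1, hm2⟩ := hE j h1 h2 h4
    refine ⟨m, hm1, hm2, mcases s m (by omega) ?_ ?_⟩
    · nlinarith
    · nlinarith
  have ha2' : 2 ≤ a := by omega
  by_cases ha2 : 2 * a < s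
  · obtain ⟨j, hj1, hj2⟩ : ∃ j : ℤ, 2 * (a * (j - 1)) < s ∧ s ≤ 2 * (a * j) := by
      refine ⟨(s - 1) / (2 * a) + 1, ?_, ?_⟩
      · have := Int.mul_ediv_self_le (x := s - 1) (k := 2 * a) (by omega)
        nlinarith
      · have := Int.lt_mul_ediv_self_add (x := s - 1) (k := 2 * a) (by omega)
        nlinarith
    have hj : 2 ≤ j := by
      by_contra hc
      have : a * j ≤ a := by nlinarith
      omega
    have hjs : 4 * (j - 1) < s := by
      have : 4 * (j - 1) ≤ 2 * (a * (j - 1)) := by nlinarith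
      omega
    by_cases hne : 2 * j = κ
    · obtain ⟨m, hm1, hm2⟩ := hE (j + 1) (by omega) (by omega) (by omega)
      have hm : 1 ≤ m := by
        by_contra hc
        have : s * m ≤ 0 := by nlinarith
        nlinarith
      have hsm : s ≤ s * m := by nlinarith
      have h4 : s < 4 * a := by nlinarith
      have hj3 : j < 3 := by
        by_contra hc
        have : 2 * a ≤ a * (j - 1) := by nlinarith
        omega
      have : j = 2 := by omega
      subst this
      obtain ⟨n, hn1, hn2, hn⟩ := E' 3 (by omega) (by omega) (by omega) (by omega)
      obtain ⟨l, hl1, hl2, hl⟩ := E' 4 (by omega) (by omega) (by omega) (by omega)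
      obtain ⟨p, hp1, hp2, hp⟩ := E' 5 (by omega) (by omega) (by omega) (by omega)
      rcases hn with rfl | rfl | rfl | rfl | rfl | rfl | rfl <;> try omega
      all_goals rcases hl with rfl | rfl | rfl | rfl | rfl | rfl | rfl <;> try omega
      all_goals rcases hp with rfl | rfl | rfl | rfl | rfl | rfl | rfl <;> omega
    · obtain ⟨m, hm1, hm2⟩ := hE j (by omega) (by omega) hne
      rcases le_or_gt m 0 with h | h
      · have : s * m ≤ 0 := by nlinarith
        nlinarith
      · have : s ≤ s * m := by nlinarith
        nlinarith
  · by_cases h2 : κ = 2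
    · obtain ⟨m, hm1, hm2, hm⟩ := E' 2 (by omega) (by omega) (by omega) (by omega)
      obtain ⟨n, hn1, hn2, hn⟩ := E' 3 (by omega) (by omega) (by omega) (by omega)
      obtain ⟨l, hl1, hl2, hl⟩ := E' 4 (by omega) (by omega) (by omega) (by omega)
      rcases hm with rfl | rfl | rfl | rfl | rfl | rfl | rfl <;> try omega
      all_goals rcases hn with rfl | rfl | rfl | rfl | rfl | rfl | rfl <;> try omega
      all_goals rcases hl with rfl | rfl | rfl | rfl | rfl | rfl | rfl <;> omega
    · obtain ⟨m, hm1, hm2, hm⟩ := E' 1 (by omega) (by omega) (by omega) (by omega)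
      rcases hm with rfl | rfl | rfl | rfl | rfl | rfl | rfl <;> omega

lemma ge_of_modEq (n V u : ℤ) (hn : 0 < n) (hV : 0 ≤ V) (hu : u < n) (h : Int.ModEq n V u) :
    u ≤ V := by
  obtain ⟨q, hq⟩ := h.dvd
  rcases le_or_gt q 0 with h | h
  · nlinarith
  · nlinarith

lemma modself (n x : ℤ) : Int.ModEq n (x % n) x := Int.mod_modEq x n

/-- The statement `F` on even classes. -/
def FF (s a c d κ : ℤ) : Prop :=
  ∀ j, 0 < j → j < s → 2 * j ≠ κ →
    (∀ i l : ℕ, 3 ≤ i + l → Int.ModEq (2 * s) (i * c + l * d) (2 * a) →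
      4 * ((-(a * j)) % s) ≤ i * ((-(2 * j * c)) % (2 * s)) + l * ((-(2 * j * d)) % (2 * s))) →
    2 * s < (-(2 * j * c)) % (2 * s) + (-(2 * j * d)) % (2 * s)

lemma FF_swap {s a c d κ : ℤ} (h : FF s a c d κ) : FF s a d c κ := by
  intro j h0 h1 h2 h3
  have := h j h0 h1 h2 (fun i l hil hm => by
    have := h3 l i (by omega) (by rwa [add_comm] at hm)
    linarith)
  linarith

lemma Vmod (s a c d j : ℤ) (i l : ℕ) (hm : Int.ModEq (2 * s) (i * c + l * d) (2 * a)) :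
    Int.ModEq (2 * s) (i * ((-(2 * j * c)) % (2 * s)) + l * ((-(2 * j * d)) % (2 * s)))
      (4 * ((-(a * j)) % s)) := by
  have h1 : Int.ModEq (2 * s) (i * ((-(2 * j * c)) % (2 * s)) + l * ((-(2 * j * d)) % (2 * s)))
      (i * (-(2 * j * c)) + l * (-(2 * j * d))) :=
    ((modself _ _).mul_left _).add ((modself _ _).mul_left _)
  have h2 : Int.ModEq (2 * s) (i * (-(2 * j * c)) + l * (-(2 * j * d))) (-(2 * j) * (2 * a)) := by
    have := hm.mul_left (-(2 * j))
    convert this using 1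
    ring
  have h3 : Int.ModEq (2 * s) (4 * ((-(a * j)) % s)) (-(2 * j) * (2 * a)) := by
    have h4 : Int.ModEq (2 * s) (2 * ((-(a * j)) % s)) (2 * (-(a * j))) :=
      (modself s (-(a * j))).mul_left'
    have h5 := h4.mul_left 2
    convert h5 using 1 <;> ring
  exact (h1.trans h2).trans h3.symm

lemma FF_E {s a c d κ : ℤ} (hs : 7 ≤ s) (h : FF s a c d κ) : ∀ j, 0 < j → j < s → 2 * j ≠ κ →
    2 * ((-(a * j)) % s) < s →
    2 * s < (-(2 * j * c)) % (2 * s) + (-(2 * j * d)) % (2 * s) := by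
  intro j h0 h1 h2 h3
  refine h j h0 h1 h2 (fun i l hil hm => ?_)
  have e1 := Int.emod_nonneg (-(2 * j * c)) (show 2 * s ≠ 0 by omega)
  have e2 := Int.emod_nonneg (-(2 * j * d)) (show 2 * s ≠ 0 by omega)
  exact ge_of_modEq (2 * s) _ _ (by omega) (by positivity) (by omega) (Vmod s a c d j i l hm)

lemma emod_eq_of (n x y : ℤ) (h0 : 0 ≤ y) (h1 : y < n) (q : ℤ) (h : x = y + n * q) : x % n = y := by
  rw [h, Int.add_mul_emod_self_left, Int.emod_eq_of_lt h0 h1]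

lemma finalstage (s a κ : ℤ) (hs : 7 ≤ s) (hκ0 : 0 ≤ κ) (hκ : 1000 * κ < 2 * s)
    (ha : IsCoprime a s) (hF : FF s a 2 (s - 1) κ) : False := by
  have hX : ∀ j, 0 < j → 2 * j < s → (-(2 * j * 2)) % (2 * s) = 2 * s - 4 * j := by
    intro j h0 h1
    exact emod_eq_of _ _ _ (by omega) (by omega) (-1) (by ring)
  have hY : ∀ j, 0 < j → 2 * j < s → (-(2 * j * (s - 1))) % (2 * s) = 2 * j := by
    intro j h0 h1
    exact emod_eq_of _ _ _ (by omega) (by omega) (-j) (by ring)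
  have ha1 : a % s = 1 := by
    apply astage s (a % s) κ hs hκ0 hκ
    · have h1 := Int.emod_nonneg a (show s ≠ 0 by omega)
      have h2 : a % s ≠ 0 := by
        intro h
        have h3 : s ∣ a := Int.dvd_of_emod_eq_zero h
        have := ha.isUnit_of_dvd' h3 dvd_rfl
        have := Int.isUnit_iff.1 this
        omega
      omega
    · exact Int.emod_lt_of_pos _ (by omega)
    · intro j h0 h1 h2
      have hmm : (a % s * j) % s = (a * j) % s := 
        (modself s a).mul_right j
      have hd := Int.mul_ediv_add_emod (a % s * j) s
      refine ⟨(a % s * j) / s, ?_, ?_⟩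
      · have := Int.emod_nonneg (a % s * j) (show s ≠ 0 by omega)
        linarith
      · by_contra hc
        have hge : s ≤ 2 * ((a * j) % s) := by rw [← hmm]; linarith
        have hlt := Int.emod_lt_of_pos (a * j) (show 0 < s by omega)
        have hd' := Int.mul_ediv_add_emod (a * j) s
        have hneg : (-(a * j)) % s = s - (a * j) % s :=
          emod_eq_of _ _ _ (by omega) (by omega) (-(a * j / s) - 1) (by linarith)
        have hne : s ≠ 2 * ((a * j) % s) := by
          intro h
          have h3 : s ∣ a * (2 * j) := ⟨2 * (a * j / s) + 1, by linarith⟩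
          have h4 : s ∣ 2 * j := ha.symm.dvd_of_dvd_mul_left h3
          have := Int.le_of_dvd (by omega) h4
          omega
        have := FF_E hs hF j h0 (by omega) h2 (by rw [hneg]; omega)
        rw [hX j h0 h1, hY j h0 h1] at this
        omega
  obtain ⟨m, hm⟩ : ∃ m, m = (s - 1) / 2 := ⟨_, rfl⟩
  have hm0 : 0 < m := by omega
  have hm1 : 2 * m < s := by omega
  have hm5 : s < 5 * m := by omega
  have hA : (-(a * m)) % s = s - m := by
    have := Int.mul_ediv_add_emod a s
    rw [ha1] at this
    refine emod_eq_of _ _ _ (by omega) (by omega) (-(a / s) * m - 1) ?_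
    rw [← this]
    have : (s * (a / s) + 1) / s = a / s := by rw [this]
    rw [this]
    ring
  have := hF m hm0 (by omega) (by omega) (fun i l hil hml => ?_)
  · rw [hX m hm0 hm1, hY m hm0 hm1] at this
    omega
  · have hV := Vmod s a 2 (s - 1) m i l hml
    rw [hX m hm0 hm1, hY m hm0 hm1, hA] at hV ⊢
    have hgt : 2 * s - 4 * m < i * (2 * s - 4 * m) + l * (2 * m) := by
      rcases Nat.eq_zero_or_pos i with rfl | hi
      · have : (3 : ℤ) ≤ l := by exact_mod_cast (by omega : 3 ≤ l)
        push_cast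
        nlinarith
      · rcases Nat.eq_zero_or_pos l with rfl | hl
        · have : (3 : ℤ) ≤ i := by exact_mod_cast (by omega : 3 ≤ i)
          push_cast
          nlinarith
        · have h1 : (1 : ℤ) ≤ i := by exact_mod_cast hi
          have h2 : (1 : ℤ) ≤ l := by exact_mod_cast hl
          nlinarith
    obtain ⟨q, hq⟩ := hV.dvd
    have : q < 1 := by nlinarith
    nlinarith

lemma s7 (a : ℤ) (ha : IsCoprime a 7) (hF : FF 7 a 3 5 0) : False := by
  have h0 : a % 7 ≠ 0 := by
    intro h
    have h3 : (7 : ℤ) ∣ a := Int.dvd_of_emod_eq_zero h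
    have := ha.isUnit_of_dvd' h3 dvd_rfl
    have := Int.isUnit_iff.1 this
    omega
  have hE := FF_E (by norm_num) hF
  have e1 := hE 1 (by norm_num) (by norm_num) (by norm_num)
  have e2 := hE 2 (by norm_num) (by norm_num) (by norm_num)
  have e3 := hE 3 (by norm_num) (by norm_num) (by norm_num)
  have e4 := hE 4 (by norm_num) (by norm_num) (by norm_num)
  have e5 := hE 5 (by norm_num) (by norm_num) (by norm_num)
  have e6 := hE 6 (by norm_num) (by norm_num) (by norm_num)
  norm_num at e1 e2 e3 e4 e5 e6
  have h7 : a % 7 = 1 ∨ a % 7 = 2 ∨ a % 7 = 3 ∨ a % 7 = 4 ∨ a % 7 = 5 ∨ a % 7 = 6 := by omega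
  rcases h7 with h | h | h | h | h | h <;> omega

lemma arith_half (s a c d κ : ℤ) (hs : 7 ≤ s) (hκ0 : 0 ≤ κ) (hκ : 1000 * κ < 2 * s)
    (ha : IsCoprime a s) (hgd : Int.gcd d (2 * s) ∣ 2)
    (hc : 0 ≤ c) (hcd : c ≤ d) (hsum : c + d = s + 1)
    (hP : ∀ k, 0 < k → k < s → k % 2 = 1 → k ≠ κ →
      ∃ m, 2 * s * m < c * k ∧ c * k < 2 * s * m + s + k)
    (hF : FF s a c d κ) : False := by
  rcases oddstage s c d κ hs hκ0 hκ hc hcd hsum hP with h | h | ⟨h7, h⟩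
  · have hd : d = s := by omega
    rw [hd] at hgd
    have h1 : s ∣ (Int.gcd s (2 * s) : ℤ) := Int.dvd_coe_gcd dvd_rfl (Dvd.intro_left 2 rfl)
    have h2 : (Int.gcd s (2 * s) : ℤ) ∣ 2 := by exact_mod_cast hgd
    have := Int.le_of_dvd (by norm_num) (h1.trans h2)
    omega
  · have hd : d = s - 1 := by omega
    subst hd
    subst h
    exact finalstage s a κ hs hκ0 hκ ha hF
  · have hd : d = 5 := by omega
    have : κ = 0 := by omega
    subst hd h h7 this
    exact s7 a ha hF

lemma arith_all (s a c d κ : ℤ) (hs : 7 ≤ s) (hκ0 : 0 ≤ κ) (hκ : 1000 * κ < 2 * s)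
    (ha : IsCoprime a s) (hgc : Int.gcd c (2 * s) ∣ 2) (hgd : Int.gcd d (2 * s) ∣ 2)
    (hc : 0 ≤ c) (hc' : c < 2 * s) (hd : 0 ≤ d) (hd' : d < 2 * s)
    (hsum : Int.ModEq (2 * s) (c + d) (1 + s))
    (hP : ∀ k, 0 < k → k < s → k % 2 = 1 → k ≠ κ →
      ∃ m, 2 * s * m < c * k ∧ c * k < 2 * s * m + s + k)
    (hP' : ∀ k, 0 < k → k < s → k % 2 = 1 → k ≠ κ →
      ∃ m, 2 * s * m < d * k ∧ d * k < 2 * s * m + s + k)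
    (hF : FF s a c d κ) : False := by
  obtain ⟨q, hq⟩ := hsum.symm.dvd
  have hq0 : -1 < q := by nlinarith
  have hq2 : q < 2 := by nlinarith
  have : q = 0 ∨ q = 1 := by omega
  rcases this with rfl | rfl
  · rcases le_total c d with h | h
    · exact arith_half s a c d κ hs hκ0 hκ ha hgd hc h (by linarith) hP hF
    · exact arith_half s a d c κ hs hκ0 hκ ha hgc hd h (by linarith) hP' (FF_swap hF)
  · rcases le_total d c with h | h
    · exact odd_big s c d κ hs hκ0 hκ hc' h (by linarith) hP
    · exact odd_big s d c κ hs hκ0 hκ hd' h (by linarith) hP'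


/-- Exclusion of the odd case: no datum in the hyperquotient setup satisfies
Rules I and II, the odd form, and `a ≢ b (mod r)`. -/
theorem statement16 :
    ∃ δstar : ℝ, 0 < δstar ∧ δstar ≤ 1 / 13 ∧
      ∀ (r : ℤ) (δ : ℝ) (a b c d e : ℤ) (S : Set (Fin 4 → ℕ)) (B : Set (Fin 4 → ℚ)),
        13 < r → 0 < δ → δ ≤ δstar →
        WeightCond r a b c d e S → RuleI r a b c d δ S B → RuleII r a b c d e →
        FormOdd S → ¬ Int.ModEq r a b → False := by
  refine ⟨1 / 1000, by norm_num, by norm_num, ?_⟩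
  intro r δ a b c d e S B hr hδ0 hδ hw hI hII hform hab
  obtain ⟨hx2, hy2, hG⟩ := hform
  obtain ⟨-, -, hgc, hgd, gab, gac, gad, -, -, -, hsum⟩ := hII
  have ea : Int.ModEq r (2 * a) e := by
    have := hw _ hx2
    simpa using this
  have eb : Int.ModEq r (2 * b) e := by
    have := hw _ hy2
    simpa using this
  have e2 : r ∣ 2 * b - 2 * a := (ea.trans eb.symm).dvd
  obtain ⟨q, hq⟩ := e2
  have hqodd : q % 2 = 1 := by
    by_contra h
    apply hab
    obtain ⟨p, hp⟩ : ∃ p, q = 2 * p := ⟨q / 2, by omega⟩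
    exact (Int.modEq_iff_dvd).2 ⟨p, by rw [hp] at hq; linarith⟩
  obtain ⟨s, rfl⟩ : ∃ s, r = 2 * s := by
    refine ⟨r / 2, ?_⟩
    have hqe := congrArg (· % 2) hq
    simp only [Int.mul_emod r q, hqodd] at hqe
    omega
  have hs : 7 ≤ s := by omega
  have hba : b = a + s * q := by
    have : 2 * b = 2 * (a + s * q) := by linarith
    omega
  obtain ⟨p, hp⟩ : ∃ p, q = 2 * p + 1 := ⟨q / 2, by omega⟩
  have hba' : Int.ModEq (2 * s) b (a + s) := by
    refine (Int.modEq_iff_dvd).2 ⟨-p, ?_⟩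
    rw [hba, hp]; ring
  have hcds : Int.ModEq (2 * s) (c + d) (1 + s) := by
    obtain ⟨u, hu⟩ := hsum.dvd
    obtain ⟨v, hv⟩ := ea.dvd
    refine (Int.modEq_iff_dvd).2 ⟨u + p + 1 - v, ?_⟩
    rw [hba, hp] at hu
    linarith
  have hcop : IsCoprime a s := by
    rw [Int.isCoprime_iff_gcd_eq_one]
    have h1 : (Int.gcd a s : ℤ) ∣ a := Int.gcd_dvd_left ..
    have h2 : (Int.gcd a s : ℤ) ∣ s := Int.gcd_dvd_right ..
    have h3 : (Int.gcd a s : ℤ) ∣ (Int.gcd a (Int.gcd b (2 * s)) : ℤ) := by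
      refine Int.dvd_coe_gcd h1 (Int.dvd_coe_gcd ?_ (h2.mul_left 2))
      rw [hba]
      exact dvd_add h1 (h2.mul_right q)
    rw [gab] at h3
    have h4 : Int.gcd a s ∣ 1 := by exact_mod_cast h3
    exact Nat.dvd_one.1 h4
  have gcd2 : ∀ x : ℤ, Int.gcd x (2 * s) ∣ Int.gcd e (2 * s) →
      Int.gcd a (Int.gcd x (2 * s)) = 1 → Int.gcd x (2 * s) ∣ 2 := by
    intro x h1 h2
    have h3 : (Int.gcd x (2 * s) : ℤ) ∣ e :=
      (Int.natCast_dvd_natCast.2 h1).trans (Int.gcd_dvd_left ..)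
    have h4 : (Int.gcd x (2 * s) : ℤ) ∣ 2 * s := Int.gcd_dvd_right ..
    have h5 : (Int.gcd x (2 * s) : ℤ) ∣ a * 2 := by
      have h6 := h4.trans ea.dvd
      have := dvd_sub h3 h6
      have e7 : e - (e - 2 * a) = a * 2 := by ring
      rwa [e7] at this
    have h6 : IsCoprime a (Int.gcd x (2 * s) : ℤ) := Int.isCoprime_iff_gcd_eq_one.2 h2
    exact_mod_cast h6.symm.dvd_of_dvd_mul_left h5
  have hgc2 := gcd2 c hgc gac
  have hgd2 := gcd2 d hgd gad
  have X0 : ∀ k, Xk (2 * s) a b c d k 0 = (-(k * a)) % (2 * s) := fun k => rfl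
  have X1 : ∀ k, Xk (2 * s) a b c d k 1 = (-(k * b)) % (2 * s) := fun k => rfl
  have X2 : ∀ k, Xk (2 * s) a b c d k 2 = (-(k * c)) % (2 * s) := fun k => rfl
  have X3 : ∀ k, Xk (2 * s) a b c d k 3 = (-(k * d)) % (2 * s) := fun k => rfl
  have hWW : ∀ k, Int.ModEq (2 * s) ((-(k * a)) % (2 * s) + (-(k * b)) % (2 * s)
      + (-(k * c)) % (2 * s) + (-(k * d)) % (2 * s)) (-k - k * e) := by
    intro k
    have h1 := (((modself (2 * s) (-(k * a))).add (modself (2 * s) (-(k * b)))).add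
      (modself (2 * s) (-(k * c)))).add (modself (2 * s) (-(k * d)))
    refine h1.trans ?_
    have h2 := (hsum.mul_left (-k)).sub (Int.ModEq.refl (k * e))
    convert h2 using 1 <;> ring
  obtain ⟨κ, hκ0, hκ, hcore⟩ := core (2 * s) δ a b c d e S B hr hδ0 hδ hI hx2 hy2
    (by
      intro k
      rw [Fin.sum_univ_four, X0, X1, X2, X3]
      have h1 := (hWW k).sub ((modself (2 * s) (-(k * a))).mul_left 2)
      refine h1.trans ?_
      have h2 := (Int.ModEq.refl (-k - k * e)).add (ea.mul_left k)
      convert h2 using 1 <;> ring)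
    (by
      intro k
      rw [Fin.sum_univ_four, X0, X1, X2, X3]
      have h1 := (hWW k).sub ((modself (2 * s) (-(k * b))).mul_left 2)
      refine h1.trans ?_
      have h2 := (Int.ModEq.refl (-k - k * e)).add (eb.mul_left k)
      convert h2 using 1 <;> ring)
  simp only [Fin.sum_univ_four, X0, X1, X2, X3] at hcore
  have nn : ∀ x : ℤ, 0 ≤ x % (2 * s) := fun x => Int.emod_nonneg _ (by omega)
  have lt : ∀ x : ℤ, x % (2 * s) < 2 * s := fun x => Int.emod_lt_of_pos _ (by omega)
  -- odd classes
  have hodd : ∀ k, 0 < k → k < s → k % 2 = 1 → k ≠ κ →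
      (-(k * c)) % (2 * s) + (-(k * d)) % (2 * s) = 3 * s - k := by
    intro k h0 h1 h2 h3
    obtain ⟨n, hn⟩ : ∃ n, k = 2 * n + 1 := ⟨k / 2, by omega⟩
    have hbk : Int.ModEq (2 * s) ((-(k * b)) % (2 * s)) ((-(k * a)) % (2 * s) + s) := by
      refine (modself _ _).trans (Int.ModEq.trans ?_ ((modself _ (-(k * a))).add_right s).symm)
      rw [← neg_mul]
      refine (hba'.mul_left (-k)).trans ?_
      refine (Int.modEq_iff_dvd).2 ⟨n + 1, ?_⟩
      rw [hn]; ring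
    have hA0 := nn (-(k * a))
    have hA1 := lt (-(k * a))
    have hB0 := nn (-(k * b))
    have hB1 := lt (-(k * b))
    have hC0 := nn (-(k * c))
    have hC1 := lt (-(k * c))
    have hD0 := nn (-(k * d))
    have hD1 := lt (-(k * d))
    have hA := modself (2 * s) (-(k * a))
    have hB := modself (2 * s) (-(k * b))
    have hC := modself (2 * s) (-(k * c))
    have hD := modself (2 * s) (-(k * d))
    have hcr := hcore k h0 (by omega) h3
    generalize (-(k * a)) % (2 * s) = A at *
    generalize (-(k * b)) % (2 * s) = Bv at *
    generalize (-(k * c)) % (2 * s) = C at *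
    generalize (-(k * d)) % (2 * s) = D at *
    have hAB : Bv = A + s ∨ Bv = A - s := by
      obtain ⟨u, hu⟩ := hbk.dvd
      have h5 : u < 2 := by nlinarith
      have h6 : -1 < u := by nlinarith
      have : u = 0 ∨ u = 1 := by omega
      rcases this with rfl | rfl
      · left; linarith
      · right; linarith
    have hmin : min A Bv < s := by
      rcases hAB with h | h
      · rw [min_eq_left (by omega)]; omega
      · rw [min_eq_right (by omega)]; omega
    have hmine : Int.ModEq (2 * s) (2 * min A Bv) (-(k * e)) := by
      rcases hAB with h | h
      · rw [min_eq_left (by omega)]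
        have := (hA.mul_left 2).trans
          (show Int.ModEq (2 * s) (2 * -(k * a)) (-(k * e)) by
            have := ea.mul_left (-k)
            convert this using 1 <;> ring)
        exact this
      · rw [min_eq_right (by omega)]
        have := (hB.mul_left 2).trans
          (show Int.ModEq (2 * s) (2 * -(k * b)) (-(k * e)) by
            have := eb.mul_left (-k)
            convert this using 1 <;> ring)
        exact this
    have hres := hcr (by omega) (by
      intro m hm
      have hwm := hw m hm
      refine ge_of_modEq (2 * s) _ _ (by omega) (by positivity) (by omega) ?_
      refine Int.ModEq.trans ?_ hmine.symm
      have h5 := (((hA.mul_left (m 0)).add (hB.mul_left (m 1))).add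
        (hC.mul_left (m 2))).add (hD.mul_left (m 3))
      refine h5.trans ?_
      have h6 := hwm.mul_left (-k)
      convert h6 using 1 <;> ring)
    have hCD : Int.ModEq (2 * s) (C + D) (s - k) := by
      refine (hC.add hD).trans ?_
      have h5 := hcds.mul_left (-k)
      have h6 : Int.ModEq (2 * s) (-k * (1 + s)) (s - k) :=
        (Int.modEq_iff_dvd).2 ⟨n + 1, by rw [hn]; ring⟩
      refine Int.ModEq.trans ?_ h6
      convert h5 using 1; ring
    have hgt : s < C + D := by
      rcases hAB with h | h
      · rw [min_eq_left (by omega)] at hres; omega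
      · rw [min_eq_right (by omega)] at hres; omega
    obtain ⟨u, hu⟩ := hCD.dvd
    have h5 : u < 0 := by nlinarith
    have h6 : -2 < u := by nlinarith
    have : u = -1 := by omega
    subst this
    linarith
  have toP : ∀ x k : ℤ, s - k < (-(k * x)) % (2 * s) →
      ∃ m, 2 * s * m < (x % (2 * s)) * k ∧ (x % (2 * s)) * k < 2 * s * m + s + k := by
    intro x k h
    have h1 := lt (-(k * x))
    have h2 := Int.mul_ediv_add_emod (-(k * x)) (2 * s)
    have h3 := Int.mul_ediv_add_emod x (2 * s)
    refine ⟨-((-(k * x)) / (2 * s)) - 1 - (x / (2 * s)) * k, ?_, ?_⟩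
    · have : (x % (2 * s)) * k = x * k - 2 * s * (x / (2 * s)) * k := by
        rw [← sub_mul]; congr 1; linarith
      rw [this]
      linarith
    · have : (x % (2 * s)) * k = x * k - 2 * s * (x / (2 * s)) * k := by
        rw [← sub_mul]; congr 1; linarith
      rw [this]
      linarith
  have modc : ∀ x y : ℤ, (-(y * (x % (2 * s)))) % (2 * s) = (-(y * x)) % (2 * s) := by
    intro x y
    exact ((modself (2 * s) x).mul_left y).neg
  have gcdc : ∀ x : ℤ, Int.gcd (x % (2 * s)) (2 * s) = Int.gcd x (2 * s) := by
    intro x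
    rw [Int.gcd_comm, Int.gcd_comm x]
    have h3 := Int.mul_ediv_add_emod x (2 * s)
    have h4 : x % (2 * s) = x + (2 * s) * (-(x / (2 * s))) := by linarith
    rw [h4]
    simp
  refine arith_all s a (c % (2 * s)) (d % (2 * s)) κ hs hκ0 hκ hcop (by rwa [gcdc]) (by rwa [gcdc])
    (nn c) (lt c) (nn d) (lt d) (((modself _ c).add (modself _ d)).trans hcds) ?_ ?_ ?_
  · intro k h0 h1 h2 h3
    apply toP
    have := hodd k h0 h1 h2 h3
    have := lt (-(k * d))
    omega
  · intro k h0 h1 h2 h3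
    apply toP
    have := hodd k h0 h1 h2 h3
    have := lt (-(k * c))
    omega
  · intro j h0 h1 h2 h3
    have hA : (-(2 * j * a)) % (2 * s) = 2 * ((-(a * j)) % s) := by
      rw [← Int.mul_emod_mul_of_pos (a := 2) _ _ (by norm_num)]
      congr 1; ring
    have hB : (-(2 * j * b)) % (2 * s) = 2 * ((-(a * j)) % s) := by
      rw [← hA]
      refine Int.ModEq.neg ?_
      refine (Int.modEq_iff_dvd).2 ⟨- j * q, ?_⟩
      rw [hba]; ring
    have hres := hcore (2 * j) (by omega) (by omega) h2 (by
      left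
      rw [hA]
      intro h
      have h4 : s ∣ a * j := by
        have : s ∣ -(a * j) := Int.dvd_of_emod_eq_zero (by omega)
        rwa [dvd_neg] at this
      have h5 := hcop.symm.dvd_of_dvd_mul_left h4
      have := Int.le_of_dvd h0 h5
      omega) (by
      intro m hm
      rw [hA, hB, min_self]
      have hA0 : 0 ≤ (-(a * j)) % s := Int.emod_nonneg _ (by omega)
      by_cases hm1 : m = ![2, 0, 0, 0]
      · subst hm1; simp
      by_cases hm2 : m = ![0, 2, 0, 0]
      · subst hm2; simp
      obtain ⟨m0, m1, m23⟩ := hG m hm hm1 hm2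
      have hwm := hw m hm
      rw [m0, m1] at hwm ⊢
      have h5 := h3 (m 2) (m 3) m23 (by
        refine Int.ModEq.trans ?_ (Int.ModEq.trans hwm ea.symm)
        have := ((modself (2 * s) c).mul_left (m 2)).add ((modself (2 * s) d).mul_left (m 3))
        convert this using 1
        push_cast; ring)
      rw [modc, modc] at h5
      push_cast
      linarith)
    rw [hA, hB, min_self] at hres
    rw [modc, modc]
    linarith

end GapPaper
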